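/- Suppose |f| ≤ 1 on ℝ, and let g : (0,∞) → ℝ be a continuous monotone increasing function with 0 < g(x) < 1 for all x > 0 and g(x) → 1 as x → +∞, such that u(x, g(x)) = 0 for every x > 0. Then for every r > 0 the following decay estimate holds: |u(2r, 1)| ≤ 2πe · exp(−r²/(4(1 − g(r)))). -/

import Mathlib

open MeasureTheory Real Filter Topology

/-- At a local maximum the second derivative is nonpositive. -/
lemma IsLocalMax.second_deriv_nonpos {φ φ' : ℝ → ℝ} {a c : ℝ} (h : IsLocalMax φ a)
    (h1 : ∀ x, HasDerivAt φ (φ' x) x) (h2 : HasDerivAt φ' c a) : c ≤ 0 := by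
  by_contra! hc
  have hd : deriv φ = φ' := funext fun x => (h1 x).deriv
  have hmin : IsLocalMin φ a := by
    apply isLocalMin_of_deriv_deriv_pos
    · rw [hd, h2.deriv]; exact hc
    · exact h.deriv_eq_zero
    · exact (h1 a).continuousAt
  have hconst : φ =ᶠ[𝓝 a] fun _ => φ a := by
    filter_upwards [h, hmin] with x hx hx' using le_antisymm hx hx'
  have : deriv φ =ᶠ[𝓝 a] fun _ => 0 := by
    have := hconst.deriv
    simpa using this
  rw [hd] at this
  have h3 := this.deriv_eq
  rw [h2.deriv] at h3
  simp at h3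
  exact hc.ne' h3

/-- A function on a half-line to the left of `b` that is maximal at `b` has nonnegative
derivative there. -/
lemma HasDerivAt.nonneg_of_eventually_le_left {φ : ℝ → ℝ} {b c : ℝ} (h : HasDerivAt φ c b)
    (hmax : ∀ᶠ t in 𝓝[<] b, φ t ≤ φ b) : 0 ≤ c := by
  have h1 := (hasDerivAt_iff_tendsto_slope.1 h).mono_left
    (nhdsWithin_mono b (fun x (hx : x < b) => hx.ne) : 𝓝[<] b ≤ 𝓝[≠] b)
  refine ge_of_tendsto h1 ?_
  filter_upwards [hmax, self_mem_nhdsWithin] with t ht htb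
  rw [slope_def_field]
  exact div_nonneg_of_nonpos (by linarith) (by have : t < b := htb; linarith)

/-- The maximum principle for solutions of the heat equation, bounded above, on the region
between the graph of `g` and the line `t = 1`, to the right of `x = r`. -/
lemma heat_maximum_principle {v vx vxx : ℝ → ℝ → ℝ} {g : ℝ → ℝ} {r M : ℝ}
    (hg : ContinuousOn g (Set.Ici r)) (hg_pos : ∀ x, r ≤ x → 0 < g x)
    (hv : ∀ x t, 0 < t → ContinuousAt (fun p : ℝ × ℝ => v p.1 p.2) (x, t))
    (hx : ∀ x t, 0 < t → HasDerivAt (fun x => v x t) (vx x t) x)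
    (hxx : ∀ x t, 0 < t → HasDerivAt (fun x => vx x t) (vxx x t) x)
    (ht : ∀ x t, 0 < t → HasDerivAt (fun t => v x t) (vxx x t) t)
    (hM : ∀ x t, 0 < t → v x t ≤ M)
    (hgraph : ∀ x, r ≤ x → v x (g x) ≤ 0)
    (hleft : ∀ t, g r ≤ t → t ≤ 1 → v r t ≤ 0)
    {x t : ℝ} (hrx : r ≤ x) (hgt : g x ≤ t) (ht1 : t ≤ 1) : v x t ≤ 0 := by
  by_contra! hpos
  have ht0 : 0 < t := (hg_pos x hrx).trans_le hgt
  have hD : 0 < x ^ 2 + 3 * t := by positivity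
  obtain ⟨ε, hε, hεv⟩ : ∃ ε > 0, 0 < v x t - ε * (x ^ 2 + 3 * t) := by
    refine ⟨v x t / (2 * (x ^ 2 + 3 * t)), by positivity, ?_⟩
    have : v x t / (2 * (x ^ 2 + 3 * t)) * (x ^ 2 + 3 * t) = v x t / 2 := by
      field_simp
    linarith
  set φ : ℝ → ℝ → ℝ := fun x t => v x t - ε * (x ^ 2 + 3 * t) with hφ
  obtain ⟨R, hxR, hR⟩ : ∃ R, x ≤ R ∧ M ≤ ε * R ^ 2 := by
    refine ⟨1 + |x| + |M| / ε, ?_, ?_⟩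
    · have := le_abs_self x
      have : 0 ≤ |M| / ε := by positivity
      linarith
    · have h1 : 0 ≤ |M| / ε := by positivity
      have h2 : ε * (|M| / ε) = |M| := by field_simp
      have h3 : |M| / ε ≤ (1 + |x| + |M| / ε) ^ 2 := by nlinarith [abs_nonneg x]
      calc M ≤ |M| := le_abs_self M
        _ = ε * (|M| / ε) := h2.symm
        _ ≤ _ := by gcongr
  set K : Set (ℝ × ℝ) := {p | p ∈ Set.Icc r R ×ˢ Set.Icc 0 1 ∧ g p.1 ≤ p.2} with hK
  have hKc : IsCompact K := by
    have hs : IsCompact (Set.Icc r R ×ˢ Set.Icc (0 : ℝ) 1) := isCompact_Icc.prod isCompact_Icc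
    refine hs.of_isClosed_subset ?_ (fun p hp => hp.1)
    refine hs.isClosed.isClosed_le ?_ continuousOn_snd
    exact (hg.mono Set.Icc_subset_Ici_self).comp continuousOn_fst (fun p hp => hp.1)
  have hKpos : ∀ p ∈ K, 0 < p.2 := fun p hp => (hg_pos _ hp.1.1.1).trans_le hp.2
  have hφc : ContinuousOn (fun p : ℝ × ℝ => φ p.1 p.2) K := by
    intro p hp
    refine ContinuousAt.continuousWithinAt ?_
    exact (hv p.1 p.2 (hKpos p hp)).sub (by fun_prop)
  have hmem : (x, t) ∈ K := ⟨⟨⟨hrx, hxR⟩, ht0.le, ht1⟩, hgt⟩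
  obtain ⟨⟨a, b⟩, hab, hmax⟩ := hKc.exists_isMaxOn ⟨_, hmem⟩ hφc
  have hb : 0 < b := hKpos _ hab
  obtain ⟨⟨⟨hra, haR⟩, -, hb1⟩, hgb⟩ := hab
  simp only at hra haR hb1 hgb
  have hφpos : 0 < φ a b := hεv.trans_le (hmax hmem)
  have hvpos : 0 < v a b := by
    have : 0 ≤ ε * (a ^ 2 + 3 * b) := by positivity
    simp only [hφ] at hφpos
    linarith
  have hra' : r < a := by
    refine hra.lt_of_ne ?_
    rintro rfl
    exact absurd (hleft b hgb hb1) (not_le.2 hvpos)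
  have haR' : a < R := by
    refine haR.lt_of_ne ?_
    rintro rfl
    have h1 := hM a b hb
    simp only [hφ] at hφpos
    nlinarith
  have hgb' : g a < b := by
    refine hgb.lt_of_ne ?_
    rintro rfl
    exact absurd (hgraph a hra) (not_le.2 hvpos)
  have hga : ContinuousAt g a := hg.continuousAt (Ici_mem_nhds hra')
  have hlocx : IsLocalMax (fun x => φ x b) a := by
    filter_upwards [Ioo_mem_nhds hra' haR', hga.eventually_lt_const hgb'] with y hy hgy
    exact hmax (show (y, b) ∈ K from ⟨⟨⟨hy.1.le, hy.2.le⟩, hb.le, hb1⟩, hgy.le⟩)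
  have hloct : ∀ᶠ s in 𝓝[<] b, φ a s ≤ φ a b := by
    filter_upwards [Ioo_mem_nhdsLT hgb'] with s hs
    exact hmax (show (a, s) ∈ K from
      ⟨⟨⟨hra, haR⟩, ((hg_pos a hra).trans hs.1).le, hs.2.le.trans hb1⟩, hs.1.le⟩)
  have h1 : vxx a b - ε * 2 ≤ 0 := by
    refine hlocx.second_deriv_nonpos (φ' := fun x => vx x b - ε * (2 * x)) (fun y => ?_) ?_
    · refine (hx y b hb).sub ?_
      have := (((hasDerivAt_id y).pow 2).add_const (3 * b)).const_mul ε
      simpa using this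
    · refine (hxx a b hb).sub ?_
      simpa using ((hasDerivAt_id a).const_mul 2).const_mul ε
  have h2 : 0 ≤ vxx a b - ε * 3 := by
    refine HasDerivAt.nonneg_of_eventually_le_left (φ := fun s => φ a s) (b := b) ?_ hloct
    refine (ht a b hb).sub ?_
    simpa using (((hasDerivAt_id b).const_mul 3).const_add (a ^ 2)).const_mul ε
  linarith

/-- The Gaussian moments of `f` about `x`. -/
noncomputable def gaussMoment (f : ℝ → ℝ) (n : ℕ) (x s : ℝ) : ℝ :=
  ∫ y : ℝ, (x - y) ^ n * exp (-s * (x - y) ^ 2) * f y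

/-- A dominating function for the integrands of `gaussMoment`, locally uniform in `x` and `s`. -/
noncomputable def gaussBound (n : ℕ) (x₀ b y : ℝ) : ℝ :=
  2 ^ n * exp b * ((1 + |y - x₀| ^ n) * exp (-(b / 2) * (y - x₀) ^ 2))

lemma integrable_gaussBound (n : ℕ) (x₀ : ℝ) {b : ℝ} (hb : 0 < b) :
    Integrable (gaussBound n x₀ b) := by
  have h : Integrable fun y : ℝ => (1 + |y| ^ n) * exp (-(b / 2) * y ^ 2) := by
    have h1 := integrable_exp_neg_mul_sq (half_pos hb)
    have h2 := (integrable_rpow_mul_exp_neg_mul_sq (half_pos hb) (s := n)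
      (by have : (0 : ℝ) ≤ n := n.cast_nonneg
          linarith)).norm
    refine (h1.add h2).congr (Eventually.of_forall fun y => ?_)
    simp only [Pi.add_apply, norm_mul, norm_eq_abs, abs_exp, rpow_natCast, abs_pow]
    ring
  exact (h.comp_sub_right x₀).const_mul _

lemma gaussMoment_integrand_le {f : ℝ → ℝ} (hf : ∀ x, |f x| ≤ 1) (n : ℕ) {x₀ b x s : ℝ}
    (hb : 0 < b) (hx : |x - x₀| ≤ 1) (hs : b ≤ s) (y : ℝ) :
    ‖(x - y) ^ n * exp (-s * (x - y) ^ 2) * f y‖ ≤ gaussBound n x₀ b y := by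
  rw [norm_mul, norm_mul, norm_eq_abs, norm_eq_abs, norm_eq_abs, abs_exp, abs_pow]
  have h1 : |x - y| ≤ 1 + |y - x₀| := by
    have := abs_sub_abs_le_abs_sub (x - y) (x - x₀)
    have h : x - y - (x - x₀) = -(y - x₀) := by ring
    rw [h, abs_neg] at this
    linarith
  have h2 : |x - y| ^ n ≤ 2 ^ n * (1 + |y - x₀| ^ n) := by
    calc |x - y| ^ n ≤ (1 + |y - x₀|) ^ n := by gcongr
      _ ≤ 2 ^ (n - 1) * (1 ^ n + |y - x₀| ^ n) := add_pow_le zero_le_one (abs_nonneg _) n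
      _ ≤ 2 ^ n * (1 + |y - x₀| ^ n) := by
        rw [one_pow]
        gcongr
        · norm_num
        · omega
  have h3 : exp (-s * (x - y) ^ 2) ≤ exp b * exp (-(b / 2) * (y - x₀) ^ 2) := by
    rw [← exp_add]
    apply exp_le_exp.2
    have h4 : (x - x₀) ^ 2 ≤ 1 := by rwa [sq_le_one_iff_abs_le_one]
    have h5 : (y - x₀) ^ 2 ≤ 2 * (x - y) ^ 2 + 2 := by
      nlinarith [sq_nonneg ((x - y) + (x - x₀))]
    nlinarith [mul_le_mul_of_nonneg_right hs (sq_nonneg (x - y)),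
      mul_le_mul_of_nonneg_left h5 hb.le]
  calc |x - y| ^ n * exp (-s * (x - y) ^ 2) * |f y|
      ≤ (2 ^ n * (1 + |y - x₀| ^ n)) * (exp b * exp (-(b / 2) * (y - x₀) ^ 2)) * 1 := by
        gcongr
        exact hf y
    _ = gaussBound n x₀ b y := by rw [gaussBound]; ring

lemma gaussMoment_integrable {f : ℝ → ℝ} (hfc : Continuous f) (hf : ∀ x, |f x| ≤ 1) (n : ℕ)
    (x : ℝ) {s : ℝ} (hs : 0 < s) :
    Integrable fun y : ℝ => (x - y) ^ n * exp (-s * (x - y) ^ 2) * f y :=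
  (integrable_gaussBound n x hs).mono' (by fun_prop)
    (Eventually.of_forall (gaussMoment_integrand_le hf n hs (by simp) le_rfl))

lemma continuousAt_gaussMoment {f : ℝ → ℝ} (hfc : Continuous f) (hf : ∀ x, |f x| ≤ 1) (n : ℕ)
    (x : ℝ) {s : ℝ} (hs : 0 < s) :
    ContinuousAt (fun p : ℝ × ℝ => gaussMoment f n p.1 p.2) (x, s) := by
  refine continuousAt_of_dominated (bound := gaussBound n x (s / 2))
    (Eventually.of_forall fun p => by fun_prop) ?_
    (integrable_gaussBound n x (half_pos hs)) (Eventually.of_forall fun y => by fun_prop)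
  have h1 : ∀ᶠ p : ℝ × ℝ in 𝓝 (x, s), p.1 ∈ Metric.closedBall x 1 :=
    continuousAt_fst.eventually (Metric.closedBall_mem_nhds x one_pos)
  have h2 : ∀ᶠ p : ℝ × ℝ in 𝓝 (x, s), s / 2 ≤ p.2 :=
    continuousAt_snd.eventually (Ici_mem_nhds (half_lt_self hs))
  filter_upwards [h1, h2] with p hp hp'
  exact Eventually.of_forall fun y => gaussMoment_integrand_le hf n (half_pos hs) hp hp' y

lemma hasDerivAt_gaussMoment_right {f : ℝ → ℝ} (hfc : Continuous f) (hf : ∀ x, |f x| ≤ 1)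
    (n : ℕ) (x : ℝ) {s : ℝ} (hs : 0 < s) :
    HasDerivAt (fun s => gaussMoment f n x s) (-gaussMoment f (n + 2) x s) s := by
  have key := hasDerivAt_integral_of_dominated_loc_of_deriv_le (μ := volume) (x₀ := s)
    (s := Set.Ici (s / 2))
    (F := fun s y => (x - y) ^ n * exp (-s * (x - y) ^ 2) * f y)
    (F' := fun s y => -((x - y) ^ (n + 2) * exp (-s * (x - y) ^ 2) * f y))
    (bound := gaussBound (n + 2) x (s / 2)) (Ici_mem_nhds (half_lt_self hs))
    (Eventually.of_forall fun p => by fun_prop) (gaussMoment_integrable hfc hf n x hs)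
    (by fun_prop) ?_ (integrable_gaussBound _ x (half_pos hs)) ?_
  · simpa only [gaussMoment, integral_neg] using key.2
  · refine Eventually.of_forall fun y σ hσ => ?_
    rw [norm_neg]
    exact gaussMoment_integrand_le hf _ (half_pos hs) (by simp) hσ y
  · refine Eventually.of_forall fun y σ _ => ?_
    have := ((((hasDerivAt_id σ).neg.mul_const ((x - y) ^ 2)).exp).const_mul
      ((x - y) ^ n)).mul_const (f y)
    refine this.congr_deriv ?_
    simp only [id, Pi.neg_apply]
    ring

lemma hasDerivAt_gaussMoment_left {f : ℝ → ℝ} (hfc : Continuous f) (hf : ∀ x, |f x| ≤ 1)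
    (n : ℕ) (x : ℝ) {s : ℝ} (hs : 0 < s) :
    HasDerivAt (fun x => gaussMoment f n x s)
      (n * gaussMoment f (n - 1) x s - 2 * s * gaussMoment f (n + 1) x s) x := by
  have key := hasDerivAt_integral_of_dominated_loc_of_deriv_le (μ := volume) (x₀ := x)
    (s := Metric.closedBall x 1)
    (F := fun x y => (x - y) ^ n * exp (-s * (x - y) ^ 2) * f y)
    (F' := fun x y => n * ((x - y) ^ (n - 1) * exp (-s * (x - y) ^ 2) * f y) -
      2 * s * ((x - y) ^ (n + 1) * exp (-s * (x - y) ^ 2) * f y))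
    (bound := fun y => n * gaussBound (n - 1) x s y + 2 * s * gaussBound (n + 1) x s y)
    (Metric.closedBall_mem_nhds x one_pos)
    (Eventually.of_forall fun p => by fun_prop) (gaussMoment_integrable hfc hf n x hs)
    (by fun_prop) ?_
    (((integrable_gaussBound _ x hs).const_mul _).add ((integrable_gaussBound _ x hs).const_mul _))
    ?_
  · refine key.2.congr_deriv ?_
    rw [integral_sub ((gaussMoment_integrable hfc hf _ x hs).const_mul _)
      ((gaussMoment_integrable hfc hf _ x hs).const_mul _), integral_const_mul,
      integral_const_mul]
    rfl
  · refine Eventually.of_forall fun y z hz => (norm_sub_le _ _).trans ?_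
    have hn : ‖(n : ℝ)‖ = n := by simp
    have h2s : ‖2 * s‖ = 2 * s := by rw [norm_eq_abs, abs_of_pos (by positivity)]
    rw [norm_mul (n : ℝ), norm_mul (2 * s), hn, h2s]
    gcongr
    · exact gaussMoment_integrand_le hf _ hs hz le_rfl y
    · exact gaussMoment_integrand_le hf _ hs hz le_rfl y
  · refine Eventually.of_forall fun y z _ => ?_
    have h := (hasDerivAt_id z).sub_const y
    have := ((h.pow n).mul (((h.pow 2).const_mul (-s)).exp)).mul_const (f y)
    refine this.congr_deriv ?_
    simp
    ring

/-- The Poisson integral of `f` for the heat equation. -/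
noncomputable def poissonHeat (f : ℝ → ℝ) (x t : ℝ) : ℝ :=
  (√(4 * π * t))⁻¹ * gaussMoment f 0 x (4 * t)⁻¹

lemma abs_poissonHeat_le {f : ℝ → ℝ} (hf : ∀ x, |f x| ≤ 1) (x : ℝ) {t : ℝ} (ht : 0 < t) :
    |poissonHeat f x t| ≤ 1 := by
  have hs : 0 < (4 * t)⁻¹ := by positivity
  have hgauss : ∫ y : ℝ, exp (-(4 * t)⁻¹ * (x - y) ^ 2) = √(4 * π * t) := by
    rw [integral_sub_left_eq_self (fun y => exp (-(4 * t)⁻¹ * y ^ 2)) volume x,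
      integral_gaussian]
    congr 1
    field_simp
  have h : |gaussMoment f 0 x (4 * t)⁻¹| ≤ √(4 * π * t) := by
    rw [← hgauss, gaussMoment, ← norm_eq_abs]
    refine norm_integral_le_of_norm_le ?_ (Eventually.of_forall fun y => ?_)
    · exact (integrable_exp_neg_mul_sq hs).comp_sub_left x
    · rw [pow_zero, one_mul, norm_mul, norm_eq_abs, norm_eq_abs, abs_exp]
      exact mul_le_of_le_one_right (exp_pos _).le (hf y)
  have hpos : 0 < √(4 * π * t) := sqrt_pos.2 (by positivity)
  rw [poissonHeat, abs_mul, abs_of_pos (inv_pos.2 hpos), inv_mul_le_iff₀ hpos, mul_one]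
  exact h

lemma continuousAt_poissonHeat {f : ℝ → ℝ} (hfc : Continuous f) (hf : ∀ x, |f x| ≤ 1)
    (x : ℝ) {t : ℝ} (ht : 0 < t) :
    ContinuousAt (fun p : ℝ × ℝ => poissonHeat f p.1 p.2) (x, t) := by
  have hne : √(4 * π * t) ≠ 0 := (sqrt_pos.2 (by positivity)).ne'
  refine ContinuousAt.mul (ContinuousAt.inv₀ (by fun_prop) hne) ?_
  have h := continuousAt_gaussMoment hfc hf 0 x (s := (4 * t)⁻¹) (by positivity)
  refine ContinuousAt.comp (f := fun p : ℝ × ℝ => (p.1, (4 * p.2)⁻¹)) (x := (x, t)) h ?_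
  exact continuousAt_fst.prodMk (ContinuousAt.inv₀ (by fun_prop) (by positivity))

/-- The first space derivative of `poissonHeat f`. -/
noncomputable def poissonHeatX (f : ℝ → ℝ) (x t : ℝ) : ℝ :=
  (√(4 * π * t))⁻¹ * (-(2 * (4 * t)⁻¹) * gaussMoment f 1 x (4 * t)⁻¹)

/-- The second space derivative of `poissonHeat f`. -/
noncomputable def poissonHeatXX (f : ℝ → ℝ) (x t : ℝ) : ℝ :=
  (√(4 * π * t))⁻¹ * (-(2 * (4 * t)⁻¹) * (gaussMoment f 0 x (4 * t)⁻¹ -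
    2 * (4 * t)⁻¹ * gaussMoment f 2 x (4 * t)⁻¹))

lemma hasDerivAt_poissonHeat_left {f : ℝ → ℝ} (hfc : Continuous f) (hf : ∀ x, |f x| ≤ 1)
    (x : ℝ) {t : ℝ} (ht : 0 < t) :
    HasDerivAt (fun x => poissonHeat f x t) (poissonHeatX f x t) x := by
  refine ((hasDerivAt_gaussMoment_left hfc hf 0 x (s := (4 * t)⁻¹)
    (by positivity)).const_mul _).congr_deriv ?_
  simp [poissonHeatX]

lemma hasDerivAt_poissonHeatX_left {f : ℝ → ℝ} (hfc : Continuous f) (hf : ∀ x, |f x| ≤ 1)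
    (x : ℝ) {t : ℝ} (ht : 0 < t) :
    HasDerivAt (fun x => poissonHeatX f x t) (poissonHeatXX f x t) x := by
  refine (((hasDerivAt_gaussMoment_left hfc hf 1 x (s := (4 * t)⁻¹)
    (by positivity)).const_mul _).const_mul _).congr_deriv ?_
  simp [poissonHeatXX]

lemma hasDerivAt_poissonHeat_right {f : ℝ → ℝ} (hfc : Continuous f) (hf : ∀ x, |f x| ≤ 1)
    (x : ℝ) {t : ℝ} (ht : 0 < t) :
    HasDerivAt (fun t => poissonHeat f x t) (poissonHeatXX f x t) t := by
  have hpos : 0 < 4 * π * t := by positivity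
  have hsq : 0 < √(4 * π * t) := sqrt_pos.2 hpos
  have h1 : HasDerivAt (fun t => (√(4 * π * t))⁻¹) (-(2 * t)⁻¹ * (√(4 * π * t))⁻¹) t := by
    have := (((hasDerivAt_id t).const_mul (4 * π)).sqrt hpos.ne').inv hsq.ne'
    refine this.congr_deriv ?_
    simp only [id, mul_one]
    rw [sq_sqrt hpos.le]
    field_simp
  have h2 : HasDerivAt (fun t : ℝ => (4 * t)⁻¹) (-4 * (4 * t)⁻¹ ^ 2) t := by
    have := ((hasDerivAt_id t).const_mul 4).inv (by simpa using ht.ne')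
    refine this.congr_deriv ?_
    simp only [id]
    field_simp
  have h3 := (hasDerivAt_gaussMoment_right hfc hf 0 x (s := (4 * t)⁻¹) (by positivity)).comp t h2
  refine (h1.mul h3).congr_deriv ?_
  simp only [poissonHeatXX, Function.comp_apply, zero_add]
  field_simp
  ring

/-- Comparison of a Poisson integral vanishing on the graph of `g` with an exponential solution
of the heat equation. -/
lemma poissonHeat_le_exp {f g : ℝ → ℝ} {r l : ℝ} (hfc : Continuous f) (hf : ∀ x, |f x| ≤ 1)
    (hg : ContinuousOn g (Set.Ici r)) (hg_pos : ∀ x, r ≤ x → 0 < g x)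
    (hvanish : ∀ x, r ≤ x → poissonHeat f x (g x) = 0) {x t : ℝ} (hrx : r ≤ x)
    (hgt : g x ≤ t) (ht1 : t ≤ 1) :
    poissonHeat f x t ≤ exp (-l * (x - r) + l ^ 2 * (t - g r)) := by
  set w : ℝ → ℝ → ℝ := fun x t => exp (-l * (x - r) + l ^ 2 * (t - g r)) with hw
  have hwx : ∀ x t, HasDerivAt (fun x => w x t) (-l * w x t) x := fun x t => by
    refine ((((hasDerivAt_id x).sub_const r).const_mul (-l)).add_const
      (l ^ 2 * (t - g r))).exp.congr_deriv ?_
    simp [hw, mul_comm]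
  have hwt : ∀ x t, HasDerivAt (fun t => w x t) (-l * (-l * w x t)) t := fun x t => by
    refine ((((hasDerivAt_id t).sub_const (g r)).const_mul (l ^ 2)).const_add
      (-l * (x - r))).exp.congr_deriv ?_
    simp only [hw, id]
    ring
  refine sub_nonpos.1 <| heat_maximum_principle (v := fun x t => poissonHeat f x t - w x t)
    (vx := fun x t => poissonHeatX f x t - -l * w x t)
    (vxx := fun x t => poissonHeatXX f x t - -l * (-l * w x t)) (M := 1) hg hg_pos
    (fun x t ht => (continuousAt_poissonHeat hfc hf x ht).sub (by fun_prop))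
    (fun x t ht => (hasDerivAt_poissonHeat_left hfc hf x ht).sub (hwx x t))
    (fun x t ht => (hasDerivAt_poissonHeatX_left hfc hf x ht).sub ((hwx x t).const_mul _))
    (fun x t ht => (hasDerivAt_poissonHeat_right hfc hf x ht).sub (hwt x t))
    (fun x t ht => ?_) (fun x hx => ?_) (fun t ht _ => ?_) hrx hgt ht1
  · have := (abs_le.1 (abs_poissonHeat_le hf x ht)).2
    have := exp_pos (-l * (x - r) + l ^ 2 * (t - g r))
    simp only [hw]
    linarith
  · simp only [hvanish x hx, hw, zero_sub, Left.neg_nonpos_iff]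
    positivity
  · have h1 := (abs_le.1 (abs_poissonHeat_le hf r ((hg_pos r le_rfl).trans_le ht))).2
    have h2 : 1 ≤ w r t := by
      apply one_le_exp
      have : 0 ≤ t - g r := sub_nonneg.2 ht
      rw [sub_self, mul_zero, zero_add]
      positivity
    linarith

lemma poissonHeat_neg (f : ℝ → ℝ) (x t : ℝ) :
    poissonHeat (fun y => -f y) x t = -poissonHeat f x t := by
  simp [poissonHeat, gaussMoment, integral_neg]

/-- If `|f| ≤ 1` and `u` vanishes on the graph of a continuous increasing function
`g : (0,∞) → (0,1)` with `g(x) → 1` as `x → ∞`, then `u` satisfies the Gaussian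
decay estimate `|u(2r,1)| ≤ 2πe·exp(−r²/(4(1 − g(r))))` for every `r > 0`. -/
theorem heat_graph_decay_estimate
    (f : ℝ → ℝ) (hf_cont : Continuous f) (hf_bdd : ∀ x, |f x| ≤ 1)
    (u : ℝ → ℝ → ℝ)
    (hu : ∀ x t, 0 < t →
      u x t = (Real.sqrt (4 * Real.pi * t))⁻¹ *
        ∫ y : ℝ, Real.exp (-((x - y) ^ 2) / (4 * t)) * f y)
    (hu0 : ∀ x, u x 0 = f x)
    (g : ℝ → ℝ) (hg_cont : ContinuousOn g (Set.Ioi 0))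
    (hg_mono : MonotoneOn g (Set.Ioi 0))
    (hg_pos : ∀ x, 0 < x → 0 < g x) (hg_lt : ∀ x, 0 < x → g x < 1)
    (hg_lim : Tendsto g atTop (𝓝 1))
    (hvanish : ∀ x, 0 < x → u x (g x) = 0) :
    ∀ r : ℝ, 0 < r →
      |u (2 * r) 1| ≤ 2 * Real.pi * Real.exp 1 * Real.exp (-(r ^ 2) / (4 * (1 - g r))) := by
  intro r hr
  have hu' : ∀ x t, 0 < t → u x t = poissonHeat f x t := fun x t ht => by
    rw [hu x t ht, poissonHeat, gaussMoment]
    congr 2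
    funext y
    rw [pow_zero, one_mul]
    congr 2
    field_simp
  have hpos : ∀ x, r ≤ x → 0 < x := fun x hx => hr.trans_le hx
  have hg : ContinuousOn g (Set.Ici r) := hg_cont.mono fun x hx => hpos x hx
  have hgp : ∀ x, r ≤ x → 0 < g x := fun x hx => hg_pos x (hpos x hx)
  have hvan : ∀ x, r ≤ x → poissonHeat f x (g x) = 0 := fun x hx => by
    rw [← hu' x (g x) (hgp x hx), hvanish x (hpos x hx)]
  have hr2 : r ≤ 2 * r := by linarith
  have hδ : 0 < 1 - g r := sub_pos.2 (hg_lt r hr)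
  have hle : g (2 * r) ≤ 1 := (hg_lt _ (hpos _ hr2)).le
  set l := r / (2 * (1 - g r)) with hl
  have hexp : -l * (2 * r - r) + l ^ 2 * (1 - g r) = -(r ^ 2) / (4 * (1 - g r)) := by
    rw [hl]
    field_simp
    ring
  have h1 := poissonHeat_le_exp (l := l) hf_cont hf_bdd hg hgp hvan hr2 hle le_rfl
  have h2 := poissonHeat_le_exp (f := fun y => -f y) (l := l) hf_cont.neg
    (fun x => by simpa using hf_bdd x) hg hgp
    (fun x hx => by rw [poissonHeat_neg, hvan x hx, neg_zero]) hr2 hle le_rfl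
  rw [poissonHeat_neg] at h2
  rw [hexp] at h1 h2
  rw [hu' _ _ one_pos]
  refine (abs_le'.2 ⟨h1, h2⟩).trans (le_mul_of_one_le_left (exp_pos _).le ?_)
  have h3 : 1 ≤ 2 * π := by linarith [pi_gt_three]
  exact one_le_mul_of_one_le_of_one_le h3 (one_le_exp zero_le_one)
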